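/- arXiv:1201.0557 — 2 statements merged into one kernel-verified Lean document; each statement's English description precedes it below -/
import Mathlib

section
/- Let A be a finite idempotent algebra in a Taylor variety and p a prime with p > |A|. Then A has a p-ary cyclic term operation. -/
structure Signature : Type 1 where
  symbols : Type
  arity : symbols → ℕ

structure UAlgebra (σ : Signature) : Type 1 where
  carrier : Type
  op : ∀ s : σ.symbols, (Fin (σ.arity s) → carrier) → carrier

inductive Term (σ : Signature) (n : ℕ) : Type
  | var : Fin n → Term σ n
  | app (s : σ.symbols) : (Fin (σ.arity s) → Term σ n) → Term σ n

def Term.eval {σ : Signature} (A : UAlgebra σ) {n : ℕ} :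
    Term σ n → (Fin n → A.carrier) → A.carrier
  | .var i, x => x i
  | .app s ts, x => A.op s fun j => Term.eval A (ts j) x

/-- `B` is a subuniverse of the algebra `A`. -/
def Subuniverse {σ : Signature} (A : UAlgebra σ) (B : Set A.carrier) : Prop :=
  ∀ (s : σ.symbols) (a : Fin (σ.arity s) → A.carrier), (∀ i, a i ∈ B) → A.op s a ∈ B

/-- `B` absorbs `A` with respect to the term `t`. -/
def AbsorbsWith {σ : Signature} (A : UAlgebra σ) (B : Set A.carrier) {n : ℕ} (t : Term σ n) : Prop :=
  ∀ (k : Fin n) (a : Fin n → A.carrier), (∀ i, i ≠ k → a i ∈ B) → t.eval A a ∈ B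

/-- `C` absorbs the subalgebra with universe `B` (inside the ambient algebra `A`)
with respect to the term `t`. -/
def AbsorbsWithIn {σ : Signature} (A : UAlgebra σ) (B C : Set A.carrier) {n : ℕ}
    (t : Term σ n) : Prop :=
  ∀ (k : Fin n) (a : Fin n → A.carrier), (∀ i, a i ∈ B) → (∀ i, i ≠ k → a i ∈ C) →
    t.eval A a ∈ C

/-- `B` is an absorbing subalgebra (subuniverse) of `A`. -/
def Absorbing {σ : Signature} (A : UAlgebra σ) (B : Set A.carrier) : Prop :=
  Subuniverse A B ∧ ∃ (n : ℕ) (t : Term σ n), AbsorbsWith A B t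

/-- `B` is a proper absorbing subalgebra of `A`: `∅ ≠ B ≠ A`. -/
def ProperAbsorbing {σ : Signature} (A : UAlgebra σ) (B : Set A.carrier) : Prop :=
  Absorbing A B ∧ B.Nonempty ∧ B ≠ Set.univ

/-- `C` is a minimal absorbing subalgebra of `A`. -/
def MinAbsorbing {σ : Signature} (A : UAlgebra σ) (C : Set A.carrier) : Prop :=
  Absorbing A C ∧ C.Nonempty ∧ ∀ C' ⊆ C, Absorbing A C' → C'.Nonempty → C' = C

/-- All (basic, equivalently term) operations of `A` are idempotent. -/
def Idempotent {σ : Signature} (A : UAlgebra σ) : Prop :=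
  ∀ (s : σ.symbols) (a : A.carrier), A.op s (fun _ => a) = a

/-- `t` is a Taylor term of the algebra `A`. -/
def IsTaylorTerm {σ : Signature} (A : UAlgebra σ) {k : ℕ} (t : Term σ k) : Prop :=
  (∀ a : A.carrier, t.eval A (fun _ => a) = a) ∧
  ∀ j : Fin k, ∃ u v : Fin k → Fin 2, u j = 0 ∧ v j = 1 ∧
    ∀ x : Fin 2 → A.carrier, t.eval A (fun i => x (u i)) = t.eval A (fun i => x (v i))

/-- The product of two algebras of the same signature. -/
def UAlgebra.prod {σ : Signature} (A B : UAlgebra σ) : UAlgebra σ where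
  carrier := A.carrier × B.carrier
  op s x := (A.op s fun i => (x i).1, B.op s fun i => (x i).2)

/-- The `k`-th power of an algebra. -/
def UAlgebra.pow {σ : Signature} (A : UAlgebra σ) (k : ℕ) : UAlgebra σ where
  carrier := Fin k → A.carrier
  op s x := fun j => A.op s fun i => x i j

/-- `R ⊆ A × B` is subdirect: both projections are onto. -/
def Subdirect2 {α β : Type} (R : Set (α × β)) : Prop :=
  (∀ a, ∃ b, (a, b) ∈ R) ∧ ∀ b, ∃ a, (a, b) ∈ R

/-- `a` and `a'` are linked in `R` (connected in the bipartite graph of `R`). -/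
def LinkedPair {α β : Type} (R : Set (α × β)) (a a' : α) : Prop :=
  Relation.ReflTransGen (fun x y => ∃ b, (x, b) ∈ R ∧ (y, b) ∈ R) a a'

/-- `R` is linked: any two elements of the projection of `R` to the first
coordinate are `R`-linked. -/
def IsLinked {α β : Type} (R : Set (α × β)) : Prop :=
  ∀ a a', (∃ b, (a, b) ∈ R) → (∃ b, (a', b) ∈ R) → LinkedPair R a a'

/-- Cyclic shift of a `k`-tuple. -/
def cycShift {α : Type} {k : ℕ} (x : Fin k → α) : Fin k → α := fun i =>
  x ⟨(i.val + 1) % k, Nat.mod_lt _ (Nat.lt_of_le_of_lt (Nat.zero_le _) i.isLt)⟩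

/-- `t` is a cyclic term of `A`: idempotent and invariant under cyclic shift. -/
def IsCyclicTerm {σ : Signature} (A : UAlgebra σ) {k : ℕ} (t : Term σ k) : Prop :=
  (∀ a : A.carrier, t.eval A (fun _ => a) = a) ∧
  ∀ x : Fin k → A.carrier, t.eval A x = t.eval A (cycShift x)

section TermLemmas

variable {σ : Signature}

/-- Simultaneous substitution of terms for the variables of a term. -/
def Term.bind {n m : ℕ} : Term σ n → (Fin n → Term σ m) → Term σ m
  | .var i, f => f i
  | .app s ts, f => .app s fun j => Term.bind (ts j) f

theorem Term.eval_bind (A : UAlgebra σ) {n m : ℕ} (t : Term σ n) (f : Fin n → Term σ m)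
    (x : Fin m → A.carrier) :
    (t.bind f).eval A x = t.eval A fun i => (f i).eval A x := by
  induction t with
  | var i => rfl
  | app s ts ih => simp only [Term.bind, Term.eval, ih]

theorem Term.eval_const {A : UAlgebra σ} (hI : Idempotent A) {n : ℕ} (t : Term σ n)
    (a : A.carrier) : t.eval A (fun _ => a) = a := by
  induction t with
  | var i => rfl
  | app s ts ih => simp only [Term.eval, ih]; exact hI s a

theorem Term.eval_hom {A B : UAlgebra σ} (h : A.carrier → B.carrier)
    (hh : ∀ s x, h (A.op s x) = B.op s fun i => h (x i)) {n : ℕ} (t : Term σ n)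
    (x : Fin n → A.carrier) : h (t.eval A x) = t.eval B fun i => h (x i) := by
  induction t with
  | var i => rfl
  | app s ts ih => simp only [Term.eval, hh, ih]

theorem Subuniverse.eval_mem {A : UAlgebra σ} {V : Set A.carrier} (hV : Subuniverse A V)
    {n : ℕ} (t : Term σ n) {x : Fin n → A.carrier} (hx : ∀ i, x i ∈ V) : t.eval A x ∈ V := by
  induction t with
  | var i => exact hx i
  | app s ts ih => exact hV s _ ih

/-- The power of an algebra with an arbitrary index type. -/
def UAlgebra.pi (A : UAlgebra σ) (ι : Type) : UAlgebra σ where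
  carrier := ι → A.carrier
  op s x := fun j => A.op s fun i => x i j

theorem UAlgebra.pi_eval (A : UAlgebra σ) (ι : Type) {n : ℕ} (t : Term σ n)
    (x : Fin n → ι → A.carrier) (j : ι) :
    t.eval (A.pi ι) x j = t.eval A fun i => x i j :=
  Term.eval_hom (A := A.pi ι) (fun y : ι → A.carrier => y j) (fun _ _ => rfl) t x

theorem Idempotent.pi {A : UAlgebra σ} (hI : Idempotent A) (ι : Type) : Idempotent (A.pi ι) :=
  fun s a => funext fun j => hI s (a j)

/-- The subalgebra on a subuniverse. -/
def UAlgebra.sub (A : UAlgebra σ) (C : Set A.carrier) (hC : Subuniverse A C) : UAlgebra σ where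
  carrier := C
  op s x := ⟨A.op s fun i => x i, hC s _ fun i => (x i).2⟩

/-- A binary relation between two algebras compatible with all basic operations. -/
def Compatible (B A : UAlgebra σ) (N : B.carrier → A.carrier → Prop) : Prop :=
  ∀ s y x, (∀ i, N (y i) (x i)) → N (B.op s y) (A.op s x)

theorem Compatible.eval {B A : UAlgebra σ} {N : B.carrier → A.carrier → Prop}
    (hN : Compatible B A N) {n : ℕ} (t : Term σ n) {y : Fin n → B.carrier}
    {x : Fin n → A.carrier} (h : ∀ i, N (y i) (x i)) : N (t.eval B y) (t.eval A x) := by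
  induction t with
  | var i => exact h i
  | app s ts ih => exact hN s _ _ ih

/-- The quotient of an algebra by an equivalence relation; the operations are induced ones when
the relation is compatible. -/
noncomputable def UAlgebra.quot (A : UAlgebra σ) (θ : Setoid A.carrier) : UAlgebra σ where
  carrier := Quotient θ
  op s x := Quotient.mk θ (A.op s fun i => (x i).out)

theorem UAlgebra.quot_op {A : UAlgebra σ} {θ : Setoid A.carrier} (hθ : Compatible A A θ.r)
    (s : σ.symbols) (x : Fin (σ.arity s) → A.carrier) :
    Quotient.mk θ (A.op s x) = (A.quot θ).op s fun i => Quotient.mk θ (x i) :=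
  Quotient.sound (hθ s _ _ fun i => θ.symm (Quotient.mk_out (x i)))

theorem Compatible.reflTransGen {A : UAlgebra σ} {D : A.carrier → A.carrier → Prop}
    (hD : Compatible A A D) (hr : ∀ a, D a a) : Compatible A A (Relation.ReflTransGen D) := by
  intro s x y h
  have key : ∀ F : Finset (Fin (σ.arity s)),
      Relation.ReflTransGen D (A.op s x) (A.op s (F.piecewise y x)) := by
    intro F
    induction F using Finset.induction_on with
    | empty => simpa using Relation.ReflTransGen.refl
    | insert j F hj ih =>
      refine ih.trans ?_
      rw [Finset.piecewise_insert]
      have h1 : F.piecewise y x = Function.update (F.piecewise y x) j (x j) := by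
        rw [eq_comm, Function.update_eq_self_iff]
        simp [hj]
      conv => arg 2; rw [h1]
      refine Relation.ReflTransGen.lift
        (fun z => A.op s (Function.update (F.piecewise y x) j z)) (fun a b hab => ?_) _ _ (h j)
      refine hD s _ _ fun i => ?_
      by_cases hi : i = j
      · subst hi; simpa using hab
      · simpa [hi] using hr _
  simpa using key Finset.univ

end TermLemmas

section Taylor

variable {σ : Signature}

/-- The algebra has a Taylor term. -/
def HasTaylorTerm (A : UAlgebra σ) : Prop := ∃ (k : ℕ) (t : Term σ k), IsTaylorTerm A t

theorem HasTaylorTerm.of_injective {A B : UAlgebra σ} (hA : HasTaylorTerm A)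
    (h : B.carrier → A.carrier) (hh : ∀ s x, h (B.op s x) = A.op s fun i => h (x i))
    (hi : Function.Injective h) : HasTaylorTerm B := by
  obtain ⟨k, t, ht, ht'⟩ := hA
  refine ⟨k, t, fun a => hi ?_, fun j => ?_⟩
  · rw [Term.eval_hom h hh]; exact ht _
  · obtain ⟨u, v, hu, hv, huv⟩ := ht' j
    refine ⟨u, v, hu, hv, fun x => hi ?_⟩
    rw [Term.eval_hom h hh, Term.eval_hom h hh]
    exact huv fun i => h (x i)

theorem HasTaylorTerm.of_surjective {A B : UAlgebra σ} (hA : HasTaylorTerm A)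
    (h : A.carrier → B.carrier) (hh : ∀ s x, h (A.op s x) = B.op s fun i => h (x i))
    (hs : Function.Surjective h) : HasTaylorTerm B := by
  obtain ⟨k, t, ht, ht'⟩ := hA
  refine ⟨k, t, fun a => ?_, fun j => ?_⟩
  · obtain ⟨a, rfl⟩ := hs a
    rw [← Term.eval_hom h hh t fun _ => a, ht]
  · obtain ⟨u, v, hu, hv, huv⟩ := ht' j
    refine ⟨u, v, hu, hv, fun x => ?_⟩
    choose y hy using fun i => hs (x i)
    simp only [← hy]
    rw [← Term.eval_hom h hh t fun i => y (u i), ← Term.eval_hom h hh t fun i => y (v i), huv y]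

end Taylor

section Absorption

variable {σ : Signature}

/-- The algebra has no proper nonempty absorbing subuniverse. -/
def AbsorptionFree (A : UAlgebra σ) : Prop :=
  ∀ V : Set A.carrier, Absorbing A V → V.Nonempty → V = Set.univ

theorem AbsorptionFree.pi {A : UAlgebra σ} (hI : Idempotent A) (hA : AbsorptionFree A)
    (ι : Type) [Finite ι] : AbsorptionFree (A.pi ι) := by
  classical
  have := Fintype.ofFinite ι
  rintro V ⟨hV, n, t, ht⟩ hne
  refine Set.eq_univ_of_forall fun (x : ι → A.carrier) => ?_
  have key : ∀ J : Finset ι, ∃ v ∈ V, ∀ i ∈ J, v i = x i := by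
    intro J
    induction J using Finset.induction_on with
    | empty => obtain ⟨v, hv⟩ := hne; exact ⟨v, hv, by simp⟩
    | insert j J hj ih =>
      have h : {a | ∃ v ∈ V, (∀ i ∈ J, v i = x i) ∧ v j = a} = Set.univ := by
        refine hA _ ⟨?_, n, t, ?_⟩ ?_
        · intro s a ha
          choose v hv hvJ hvj using ha
          refine ⟨(A.pi ι).op s v, hV s v hv, fun i hi => ?_, ?_⟩
          · change A.op s (fun m => v m i) = _
            simp only [hvJ _ i hi]
            exact hI s _
          · change A.op s (fun m => v m j) = _
            simp only [hvj]
        · intro k a ha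
          have hex : ∀ m, ∃ v : ι → A.carrier, (m ≠ k → v ∈ V) ∧ (∀ i ∈ J, v i = x i) ∧
              v j = a m := by
            intro m
            by_cases hm : m = k
            · refine ⟨Function.update x j (a m), fun h => absurd hm h, fun i hi => ?_, by simp⟩
              rw [Function.update_of_ne]
              rintro rfl
              exact hj hi
            · obtain ⟨v, h1, h2, h3⟩ := ha m hm
              exact ⟨v, fun _ => h1, h2, h3⟩
          choose v hv hvJ hvj using hex
          refine ⟨t.eval (A.pi ι) v, ht k v hv, fun i hi => ?_, ?_⟩
          · rw [UAlgebra.pi_eval]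
            simp only [hvJ _ i hi]
            exact Term.eval_const hI t _
          · rw [UAlgebra.pi_eval]
            simp only [hvj]
        · obtain ⟨v, hv, hvJ⟩ := ih
          exact ⟨v j, v, hv, hvJ, rfl⟩
      obtain ⟨v, hv, hvJ, hvj⟩ : x j ∈ {a | ∃ v ∈ V, (∀ i ∈ J, v i = x i) ∧ v j = a} := by
        rw [h]; trivial
      refine ⟨v, hv, fun i hi => ?_⟩
      rcases Finset.mem_insert.1 hi with rfl | hi
      · exact hvj
      · exact hvJ i hi
  obtain ⟨v, hv, h⟩ := key Finset.univ
  have : v = x := funext fun i => h i (Finset.mem_univ i)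
  exact this ▸ hv

/-- The values of a term whose `i`-th argument is taken from `B`. -/
def Term.reach (A : UAlgebra σ) {n : ℕ} (t : Term σ n) (i : Fin n) (B : Set A.carrier) :
    Set A.carrier :=
  {b | ∃ x : Fin n → A.carrier, x i ∈ B ∧ t.eval A x = b}

theorem Term.subset_reach {A : UAlgebra σ} (hI : Idempotent A) {n : ℕ} (t : Term σ n)
    (i : Fin n) (B : Set A.carrier) : B ⊆ t.reach A i B :=
  fun b hb => ⟨fun _ => b, hb, Term.eval_const hI t b⟩

theorem Term.reach_mono {A : UAlgebra σ} {n : ℕ} (t : Term σ n) (i : Fin n)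
    {B C : Set A.carrier} (h : B ⊆ C) : t.reach A i B ⊆ t.reach A i C :=
  fun _ ⟨x, hx, hb⟩ => ⟨x, h hx, hb⟩

/-- The composition `t(u, …, u)` with pairwise disjoint blocks of variables. -/
def Term.star {n m : ℕ} (t : Term σ n) (u : Term σ m) : Term σ (n * m) :=
  t.bind fun i => u.bind fun j => .var (finProdFinEquiv (i, j))

theorem Term.reach_star (A : UAlgebra σ) {n m : ℕ} (t : Term σ n) (u : Term σ m)
    (i : Fin n) (j : Fin m) (hI : Idempotent A) (B : Set A.carrier) :
    t.reach A i (u.reach A j B) ⊆ (t.star u).reach A (finProdFinEquiv (i, j)) B := by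
  rintro b ⟨x, ⟨y, hy, hyx⟩, rfl⟩
  refine ⟨fun l => if (finProdFinEquiv.symm l).1 = i then y (finProdFinEquiv.symm l).2
    else x (finProdFinEquiv.symm l).1, by simpa using hy, ?_⟩
  simp only [Term.star, Term.eval_bind, Term.eval, Equiv.symm_apply_apply]
  congr 1
  funext l
  by_cases hl : l = i
  · subst hl; simpa using hyx
  · simpa [hl] using Term.eval_const hI u (x l)

theorem AbsorptionFree.exists_expanding {A : UAlgebra σ} [Finite A.carrier]
    (hI : Idempotent A) (hT : HasTaylorTerm A) (hA : AbsorptionFree A) :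
    ∃ (n : ℕ) (t : Term σ n), ∀ (i : Fin n) (B : Set A.carrier), B.Nonempty → B ≠ Set.univ →
      ¬ t.reach A i B ⊆ B := by
  classical
  have single : ∀ B : Set A.carrier, B.Nonempty → B ≠ Set.univ →
      ∃ (n : ℕ) (t : Term σ n), ∀ i, ¬ t.reach A i B ⊆ B := by
    intro B hne hB
    by_cases hsub : Subuniverse A B
    · obtain ⟨k, t, -, ht⟩ := hT
      refine ⟨k, t, fun j hj => hB (hA B ⟨hsub, 2, ?_⟩ hne)⟩
      obtain ⟨u, v, hu, hv, huv⟩ := ht j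
      refine ⟨t.bind fun i => .var (u i), fun l a ha => ?_⟩
      rw [Term.eval_bind]
      simp only [Term.eval]
      by_cases hl : l = 0
      · rw [huv a]
        exact hj ⟨_, by rw [hv]; exact ha 1 (by simp [hl]), rfl⟩
      · exact hj ⟨_, by rw [hu]; exact ha 0 (Ne.symm hl), rfl⟩
    · simp only [Subuniverse, not_forall] at hsub
      obtain ⟨s, a, ha, hs⟩ := hsub
      exact ⟨_, .app s .var, fun i h => hs (h ⟨a, ha i, rfl⟩)⟩
  have := Fintype.ofFinite A.carrier
  have many : ∀ F : Finset (Set A.carrier), ∃ (n : ℕ) (t : Term σ n), ∀ (i : Fin n), ∀ B ∈ F,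
      B.Nonempty → B ≠ Set.univ → ¬ t.reach A i B ⊆ B := by
    intro F
    induction F using Finset.induction_on with
    | empty => exact ⟨1, .var 0, by simp⟩
    | insert B F _ ih =>
      obtain ⟨n, t, ht⟩ := ih
      by_cases hB : B.Nonempty ∧ B ≠ Set.univ
      · obtain ⟨m, u, hu⟩ := single B hB.1 hB.2
        refine ⟨n * m, t.star u, fun l C hC hne hCu hsub => ?_⟩
        obtain ⟨⟨i, j⟩, rfl⟩ := finProdFinEquiv.surjective l
        have h := (Term.reach_star A t u i j hI C).trans hsub
        rcases Finset.mem_insert.1 hC with rfl | hC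
        · exact hu j ((Term.subset_reach hI t i _).trans h)
        · exact ht i C hC hne hCu ((Term.reach_mono t i (Term.subset_reach hI u j C)).trans h)
      · refine ⟨n, t, fun i C hC hne hCu => ?_⟩
        rcases Finset.mem_insert.1 hC with rfl | hC
        · exact absurd ⟨hne, hCu⟩ hB
        · exact ht i C hC hne hCu
  obtain ⟨n, t, ht⟩ := many (Set.finite_univ (α := Set A.carrier)).toFinset
  exact ⟨n, t, fun i B => ht i B (by simp)⟩

/-- Every value is attained by the term with any single argument prescribed. -/
def Term.IsTransitive (A : UAlgebra σ) {n : ℕ} (t : Term σ n) : Prop :=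
  ∀ (i : Fin n) (a b : A.carrier), ∃ x : Fin n → A.carrier, x i = a ∧ t.eval A x = b

theorem AbsorptionFree.exists_transitive {A : UAlgebra σ} [Finite A.carrier]
    (hI : Idempotent A) (hT : HasTaylorTerm A) (hA : AbsorptionFree A) :
    ∃ (n : ℕ) (t : Term σ n), t.IsTransitive A := by
  obtain ⟨m, u, hu⟩ := hA.exists_expanding hI hT
  have key : ∀ k : ℕ, ∃ (n : ℕ) (t : Term σ n), ∀ i a,
      t.reach A i {a} = Set.univ ∨ k ≤ (t.reach A i {a}).ncard := by
    intro k
    induction k with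
    | zero => exact ⟨1, .var 0, by simp⟩
    | succ k ih =>
      obtain ⟨n, t, ht⟩ := ih
      refine ⟨m * n, u.star t, fun l a => ?_⟩
      obtain ⟨⟨i, j⟩, rfl⟩ := finProdFinEquiv.surjective l
      have hstar := Term.reach_star A u t i j hI {a}
      have hext := Term.subset_reach hI u i (t.reach A j {a})
      by_cases hun : t.reach A j {a} = Set.univ
      · exact Or.inl (Set.univ_subset_iff.1 (hun ▸ (hext.trans hstar)))
      · right
        have hne : (t.reach A j {a}).Nonempty :=
          ⟨a, Term.subset_reach hI t j {a} rfl⟩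
        have hss : t.reach A j {a} ⊂ u.reach A i (t.reach A j {a}) := ⟨hext, hu i _ hne hun⟩
        have h1 := Set.ncard_lt_ncard hss (Set.toFinite _)
        have h2 := Set.ncard_le_ncard hstar (Set.toFinite _)
        have h3 := (ht j a).resolve_left hun
        omega
  obtain ⟨n, t, ht⟩ := key (Nat.card A.carrier)
  refine ⟨n, t, fun i a b => ?_⟩
  have hun : t.reach A i {a} = Set.univ := by
    rcases ht i a with h | h
    · exact h
    · exact Set.eq_of_subset_of_ncard_le (Set.subset_univ _) (by rw [Set.ncard_univ]; exact h)
  obtain ⟨x, hx, hxb⟩ : b ∈ t.reach A i {a} := hun ▸ trivial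
  exact ⟨x, hx, hxb⟩

end Absorption

section CommonNeighbour

variable {σ : Signature}

theorem Compatible.eq_top_of_common_neighbour {A Y : UAlgebra σ} [Finite A.carrier]
    [Nonempty A.carrier] (hIA : Idempotent A) (hA : AbsorptionFree A)
    (hY : AbsorptionFree Y) {n : ℕ} {w : Term σ n} (hw : w.IsTransitive A)
    {N : Y.carrier → A.carrier → Prop} (hN : Compatible Y A N) (htot : ∀ y, ∃ a, N y a)
    (hcom : ∀ a a', ∃ y, N y a ∧ N y a') (y : Y.carrier) (a : A.carrier) : N y a := by
  have common : ∀ (k : ℕ) (x : Fin k → A.carrier), ∃ y, ∀ i, N y (x i) := by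
    intro k
    induction k with
    | zero =>
      obtain ⟨y, -⟩ := hcom (Classical.arbitrary _) (Classical.arbitrary _)
      exact fun x => ⟨y, fun i => i.elim0⟩
    | succ k ih =>
      have hC : {x : (A.pi (Fin k)).carrier | ∀ a, ∃ y, N y a ∧ ∀ i : Fin k, N y (x i)} =
          Set.univ := by
        refine hA.pi hIA (Fin k) _ ⟨?_, n, w, ?_⟩ ?_
        · intro s x hx a
          choose y hy hyx using fun m => hx m a
          refine ⟨Y.op s y, ?_, fun i => hN s y _ fun m => hyx m i⟩
          have := hN s y _ hy
          rwa [hIA s a] at this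
        · intro j x hx a
          obtain ⟨yj, hyj⟩ := ih (x j)
          obtain ⟨aj, haj⟩ := htot yj
          obtain ⟨b, hbj, hb⟩ := hw j aj a
          have hex : ∀ m, ∃ y, N y (b m) ∧ ∀ i : Fin k, N y (x m i) := by
            intro m
            by_cases hm : m = j
            · subst hm; exact ⟨yj, hbj ▸ haj, hyj⟩
            · exact hx m hm (b m)
          choose y hy hyx using hex
          refine ⟨w.eval Y y, hb ▸ hN.eval w hy, fun i => ?_⟩
          exact (congrArg (N _) (UAlgebra.pi_eval A (Fin k) w x i)).mpr
            (hN.eval w fun m => hyx m i)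
        · refine ⟨fun _ => Classical.arbitrary A.carrier, fun a => ?_⟩
          obtain ⟨y, h1, h2⟩ := hcom a (Classical.arbitrary _)
          exact ⟨y, h1, fun _ => h2⟩
      intro x
      obtain ⟨y, h0, hs⟩ : ∃ y, N y (x 0) ∧ ∀ i : Fin k, N y (x i.succ) := by
        have : (fun i : Fin k => x i.succ) ∈
            {x : (A.pi (Fin k)).carrier | ∀ a, ∃ y, N y a ∧ ∀ i : Fin k, N y (x i)} := by
          rw [hC]; trivial
        exact this (x 0)
      exact ⟨y, fun i => Fin.cases h0 hs i⟩
  have hC : {y | ∀ a, N y a} = Set.univ := by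
    refine hY _ ⟨?_, n, w, ?_⟩ ?_
    · intro s y hy a
      have := hN s y (fun _ => a) fun m => hy m a
      rwa [hIA s a] at this
    · intro j y hy a
      obtain ⟨aj, haj⟩ := htot (y j)
      obtain ⟨b, hbj, rfl⟩ := hw j aj a
      refine hN.eval w fun m => ?_
      by_cases hm : m = j
      · subst hm; exact hbj ▸ haj
      · exact hy m hm _
    · obtain ⟨y, hy⟩ := common _ (Finite.equivFin A.carrier).symm
      exact ⟨y, fun a => by simpa using hy (Finite.equivFin A.carrier a)⟩
  have : y ∈ {y | ∀ a, N y a} := by rw [hC]; trivial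
  exact this a

theorem Compatible.comp {A B C : UAlgebra σ} {M : A.carrier → B.carrier → Prop}
    {N : B.carrier → C.carrier → Prop} (hM : Compatible A B M) (hN : Compatible B C N) :
    Compatible A C (Relation.Comp M N) := by
  intro s x z h
  choose y h1 h2 using h
  exact ⟨B.op s y, hM s x y h1, hN s y z h2⟩

theorem Compatible.swap {A B : UAlgebra σ} {M : A.carrier → B.carrier → Prop}
    (hM : Compatible A B M) : Compatible B A (Function.swap M) :=
  fun s y x h => hM s x y h

theorem AbsorptionFree.eq_top_of_symmetric {A : UAlgebra σ} [Finite A.carrier]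
    [Nonempty A.carrier] (hI : Idempotent A) (hA : AbsorptionFree A) {n : ℕ} {w : Term σ n}
    (hw : w.IsTransitive A) {D : A.carrier → A.carrier → Prop} (hD : Compatible A A D)
    (hr : ∀ a, D a a) (hs : ∀ a b, D a b → D b a)
    (hc : ∀ a b, Relation.ReflTransGen D a b) (a b : A.carrier) : D a b := by
  induction hk : {q : A.carrier × A.carrier | ¬ D q.1 q.2}.ncard using Nat.strong_induction_on
    generalizing D a b with
  | _ k ih =>
    by_cases ht : ∀ a b c, D a b → D b c → D a c
    · have := hc a b
      induction this with
      | refl => exact hr _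
      | tail _ h h' => exact ht _ _ _ h' h
    · push Not at ht
      obtain ⟨x, y, z, hxy, hyz, hxz⟩ := ht
      have hle : ∀ a b, D a b → Relation.Comp D D a b := fun a b h => ⟨a, hr a, h⟩
      refine hD.eq_top_of_common_neighbour hI hA hA hw (fun y => ⟨y, hr y⟩)
        (fun a a' => ?_) a b
      have hlt : {q : A.carrier × A.carrier | ¬ Relation.Comp D D q.1 q.2}.ncard < k := by
        rw [← hk]
        refine Set.ncard_lt_ncard ⟨fun q hq h => hq (hle _ _ h), fun h => ?_⟩ (Set.toFinite _)
        exact h (a := (x, z)) hxz ⟨y, hxy, hyz⟩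
      obtain ⟨c, h1, h2⟩ := ih _ hlt (hD.comp hD) (fun a => ⟨a, hr a, hr a⟩)
        (fun a b ⟨c, h1, h2⟩ => ⟨c, hs _ _ h2, hs _ _ h1⟩)
        (fun a b => Relation.ReflTransGen.mono hle _ _ (hc a b)) a a' rfl
      exact ⟨c, hs _ _ h1, h2⟩

/-- A linked compatible relation between absorption free algebras, total on both sides, is
full. -/
theorem AbsorptionFree.eq_top_of_linked {A Y : UAlgebra σ} [Finite A.carrier]
    [Nonempty A.carrier] (hIA : Idempotent A) (hT : HasTaylorTerm A)
    (hA : AbsorptionFree A) (hY : AbsorptionFree Y) {N : Y.carrier → A.carrier → Prop}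
    (hN : Compatible Y A N) (htot : ∀ y, ∃ a, N y a) (htot' : ∀ a, ∃ y, N y a)
    (hc : ∀ a b, Relation.ReflTransGen (fun a b => ∃ y, N y a ∧ N y b) a b)
    (y : Y.carrier) (a : A.carrier) : N y a := by
  obtain ⟨n, w, hw⟩ := hA.exists_transitive hIA hT
  refine hN.eq_top_of_common_neighbour hIA hA hY hw htot ?_ y a
  exact hA.eq_top_of_symmetric hIA hw (hN.swap.comp hN)
    (fun a => (htot' a).imp fun y h => ⟨h, h⟩) (fun a b ⟨y, h1, h2⟩ => ⟨y, h2, h1⟩) hc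

end CommonNeighbour

section Advance

variable {σ : Signature}

/-- `S` absorbs the relation `L` with respect to the term `t`. -/
def RelAbsorbs (A : UAlgebra σ) {n : ℕ} (t : Term σ n) (S L : A.carrier → A.carrier → Prop) :
    Prop :=
  ∀ (k : Fin n) (x y : Fin n → A.carrier), (∀ m, m ≠ k → S (x m) (y m)) → L (x k) (y k) →
    S (t.eval A x) (t.eval A y)

/-- Some relation absorbing `L`, total on both sides, maps `V` into `U`. -/
def Advances (A : UAlgebra σ) {n : ℕ} (t : Term σ n) (V U : Set A.carrier)
    (L : A.carrier → A.carrier → Prop) : Prop :=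
  ∃ S : A.carrier → A.carrier → Prop, RelAbsorbs A t S L ∧ (∀ a, ∃ b, S a b) ∧
    (∀ b, ∃ a, S a b) ∧ ∀ a ∈ V, ∀ b, S a b → b ∈ U

variable {A : UAlgebra σ} {n : ℕ} {t : Term σ n} {V U W : Set A.carrier}
  {L L' : A.carrier → A.carrier → Prop}

theorem Advances.mono (h : Advances A t V U L) (hL : ∀ a b, L' a b → L a b) :
    Advances A t V U L' :=
  let ⟨S, h1, h2⟩ := h
  ⟨S, fun k x y hS hk => h1 k x y hS (hL _ _ hk), h2⟩

theorem Advances.comp (h : Advances A t V U L) (h' : Advances A t U W L') :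
    Advances A t V W (Relation.Comp L L') := by
  obtain ⟨S, h1, h2, h3, h4⟩ := h
  obtain ⟨S', h1', h2', h3', h4'⟩ := h'
  refine ⟨Relation.Comp S S', fun k x z hS hk => ?_, fun a => ?_, fun c => ?_,
    fun a ha c ⟨b, hab, hbc⟩ => h4' b (h4 a ha b hab) c hbc⟩
  · obtain ⟨c, hc, hc'⟩ := hk
    have hex : ∀ m, ∃ y, (m ≠ k → S (x m) y ∧ S' y (z m)) ∧ (m = k → y = c) := by
      intro m
      by_cases hm : m = k
      · exact ⟨c, fun h => absurd hm h, fun _ => rfl⟩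
      · obtain ⟨y, hy⟩ := hS m hm
        exact ⟨y, fun _ => hy, fun h => absurd h hm⟩
    choose y hy hyk using hex
    have hk := hyk k rfl
    exact ⟨t.eval A y, h1 k x y (fun m hm => (hy m hm).1) (hk ▸ hc),
      h1' k y z (fun m hm => (hy m hm).2) (hk ▸ hc')⟩
  · obtain ⟨b, hb⟩ := h2 a
    obtain ⟨c, hc⟩ := h2' b
    exact ⟨c, b, hb, hc⟩
  · obtain ⟨b, hb⟩ := h3' c
    obtain ⟨a, ha⟩ := h3 b
    exact ⟨a, b, ha, hb⟩

theorem Advances.eq_univ_of_top (hI : Idempotent A) (hV : V.Nonempty)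
    (h : Advances A t V V fun _ _ => True) : V = Set.univ := by
  obtain ⟨S, hS, h2, h3, h4⟩ := h
  choose succ hsucc using h2
  choose pred hpred using h3
  obtain ⟨b, hb⟩ := hV
  refine Set.eq_univ_of_forall fun a => ?_
  let e : ℕ → A.carrier := fun i =>
    t.eval A fun m : Fin n => if m.1 < i then pred^[n - i] a else succ^[i] b
  have hstep : ∀ i, i < n → S (e i) (e (i + 1)) := by
    intro i hi
    refine hS ⟨i, hi⟩ _ _ (fun m hm => ?_) trivial
    have hm' : m.1 ≠ i := fun h => hm (Fin.ext h)
    by_cases hlt : m.1 < i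
    · have h1 : n - i = (n - (i + 1)) + 1 := by omega
      simp only [hlt, if_true, Nat.lt_succ_of_lt hlt, h1, Function.iterate_succ_apply']
      exact hpred _
    · have h1 : ¬ m.1 < i + 1 := by omega
      simp only [hlt, h1, if_false, Function.iterate_succ_apply']
      exact hsucc _
  have hmem : ∀ i, i ≤ n → e i ∈ V := by
    intro i
    induction i with
    | zero =>
      intro _
      have : e 0 = b := by simpa [e] using Term.eval_const hI t b
      rwa [this]
    | succ i ih => exact fun hi => h4 _ (ih (by omega)) _ (hstep i (by omega))
  have : e n = a := by simpa [e] using Term.eval_const hI t a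
  exact this ▸ hmem n le_rfl

theorem Advances.eq_univ_of_linked [Finite A.carrier] (hI : Idempotent A) (hV : V.Nonempty)
    (h : Advances A t V V L) (hr : ∀ a, L a a) (hc : ∀ a b, Relation.ReflTransGen L a b) :
    V = Set.univ := by
  classical
  have := Fintype.ofFinite A.carrier
  have pair : ∀ a b, ∃ M : A.carrier → A.carrier → Prop,
      Advances A t V V M ∧ (∀ a, M a a) ∧ M a b := by
    intro a b
    induction hc a b with
    | refl => exact ⟨L, h, hr, hr _⟩
    | tail _ hbc ih =>
      obtain ⟨M, h1, h2, h3⟩ := ih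
      exact ⟨_, h1.comp h, fun a => ⟨a, h2 a, hr a⟩, _, h3, hbc⟩
  have many : ∀ F : Finset (A.carrier × A.carrier), ∃ M : A.carrier → A.carrier → Prop,
      Advances A t V V M ∧ (∀ a, M a a) ∧ ∀ q ∈ F, M q.1 q.2 := by
    intro F
    induction F using Finset.induction_on with
    | empty => exact ⟨L, h, hr, by simp⟩
    | insert q F _ ih =>
      obtain ⟨M, h1, h2, h3⟩ := ih
      obtain ⟨M', h1', h2', h3'⟩ := pair q.1 q.2
      refine ⟨_, h1.comp h1', fun a => ⟨a, h2 a, h2' a⟩, fun r hr => ?_⟩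
      rcases Finset.mem_insert.1 hr with rfl | hr
      · exact ⟨_, h2 _, h3'⟩
      · exact ⟨_, h3 r hr, h2' _⟩
  obtain ⟨M, h1, -, h3⟩ := many Finset.univ
  exact (h1.mono fun a b _ => h3 (a, b) (Finset.mem_univ _)).eq_univ_of_top hI hV

end Advance

section CyclicRelations

variable {σ : Signature}

/-- `R` is a nonempty subpower of `A`, indexed by `ZMod p` and invariant under the shift. -/
structure IsCyclicSubpower (A : UAlgebra σ) (p : ℕ) (R : Set (ZMod p → A.carrier)) : Prop where
  nonempty : R.Nonempty
  op_mem : ∀ s (r : Fin (σ.arity s) → ZMod p → A.carrier), (∀ i, r i ∈ R) →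
    (fun j => A.op s fun i => r i j) ∈ R
  shift_mem : ∀ r ∈ R, (fun i => r (i + 1)) ∈ R

/-- Every cyclic subpower contains a constant tuple. -/
def HasConstantTuples (A : UAlgebra σ) (p : ℕ) : Prop :=
  ∀ R, IsCyclicSubpower A p R → ∃ a, (fun _ => a) ∈ R

namespace IsCyclicSubpower

variable {A : UAlgebra σ} {p : ℕ} {R : Set (ZMod p → A.carrier)}

theorem eval_mem (hR : IsCyclicSubpower A p R) {n : ℕ} (t : Term σ n)
    {r : Fin n → ZMod p → A.carrier} (hr : ∀ i, r i ∈ R) :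
    (fun j => t.eval A fun i => r i j) ∈ R := by
  induction t with
  | var i => exact hr i
  | app s ts ih => exact hR.op_mem s _ ih

theorem shift_nat_mem (hR : IsCyclicSubpower A p R) {r : ZMod p → A.carrier} (hr : r ∈ R)
    (n : ℕ) : (fun i => r (i + n)) ∈ R := by
  induction n with
  | zero => simpa using hr
  | succ n ih =>
    have := hR.shift_mem _ ih
    simpa [add_assoc, add_comm, add_left_comm] using this

theorem exists_const_of_sub (hR : IsCyclicSubpower A p R)
    {C : Set A.carrier} (hC : Subuniverse A C) (h : HasConstantTuples (A.sub C hC) p)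
    (hr : ∃ r ∈ R, ∀ i, r i ∈ C) : ∃ a, (fun _ => a) ∈ R := by
  obtain ⟨r, hr, hrC⟩ := hr
  obtain ⟨a, ha⟩ := h {z | (fun i => (z i).1) ∈ R}
    ⟨⟨fun i => ⟨r i, hrC i⟩, hr⟩, fun s z hz => hR.op_mem s _ hz,
      fun z hz => hR.shift_mem _ hz⟩
  exact ⟨a.1, ha⟩

theorem exists_block_of_quot (hR : IsCyclicSubpower A p R) {θ : Setoid A.carrier}
    (hθ : Compatible A A θ.r) (h : HasConstantTuples (A.quot θ) p) :
    ∃ r ∈ R, ∃ a, ∀ i, θ.r (r i) a := by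
  have hQ : IsCyclicSubpower (A.quot θ) p
      {z | ∃ r ∈ R, ∀ i, Quotient.mk θ (r i) = z i} := by
    refine ⟨?_, fun s z hz => ?_, ?_⟩
    · obtain ⟨r, hr⟩ := hR.nonempty
      exact ⟨fun i => Quotient.mk θ (r i), r, hr, fun _ => rfl⟩
    · choose r hr hrz using hz
      refine ⟨_, hR.op_mem s r hr, fun j => ?_⟩
      rw [UAlgebra.quot_op hθ]
      simp only [hrz]
      rfl
    · rintro z ⟨r, hr, hrz⟩
      exact ⟨_, hR.shift_mem r hr, fun i => hrz _⟩
  obtain ⟨a, r, hr, ha⟩ := h _ hQ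
  obtain ⟨a, rfl⟩ := Quotient.exists_rep a
  exact ⟨r, hr, a, fun i => Quotient.exact (ha i)⟩

variable [Fact p.Prime]

theorem shift_by_mem (hR : IsCyclicSubpower A p R) {r : ZMod p → A.carrier} (hr : r ∈ R)
    (d : ZMod p) : (fun i => r (i + d)) ∈ R := by
  simpa using hR.shift_nat_mem hr d.val

theorem prime_dvd_card [Finite A.carrier] (hR : IsCyclicSubpower A p R)
    (hc : ∀ a, (fun _ => a) ∉ R) : p ∣ Nat.card R := by
  classical
  have := Fintype.ofFinite R
  let f : Function.End R := fun r => ⟨fun i => r.1 (i + 1), hR.shift_mem r.1 r.2⟩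
  have hpow : ∀ (n : ℕ) (r : R) (i : ZMod p), ((f ^ n) r).1 i = r.1 (i + n) := by
    intro n
    induction n with
    | zero => intro r i; rw [Nat.cast_zero, add_zero]; rfl
    | succ n ih =>
      intro r i
      rw [pow_succ]
      change ((f ^ n) (f r)).1 i = _
      rw [ih]
      simp [f, add_assoc]
  have hf : f ^ p ^ 1 = 1 := by
    funext r
    refine Subtype.ext (funext fun i => ?_)
    rw [hpow, pow_one, CharP.cast_eq_zero, add_zero]
    rfl
  have h := Equiv.Perm.card_fixedPoints_modEq hf
  have hfix : IsEmpty f.fixedPoints := by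
    refine ⟨fun ⟨r, hr⟩ => hc (r.1 0) ?_⟩
    have hconst : ∀ d : ZMod p, r.1 d = r.1 0 := by
      intro d
      have h1 : (f ^ d.val) r = r := by
        have : ∀ n : ℕ, (f ^ n) r = r := by
          intro n
          induction n with
          | zero => rfl
          | succ n ih =>
            rw [pow_succ]
            change (f ^ n) (f r) = r
            rw [show f r = r from hr, ih]
        exact this _
      have h2 := hpow d.val r 0
      rw [h1] at h2
      simpa using h2.symm
    have : (fun _ => r.1 0) = r.1 := funext fun d => (hconst d).symm
    rw [this]
    exact r.2
  rw [Fintype.card_eq_zero (α := f.fixedPoints)] at h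
  rw [Nat.card_eq_fintype_card]
  exact (Nat.modEq_zero_iff_dvd).1 h

end IsCyclicSubpower

/-- A cyclic subpower without constant tuples of an algebra which is minimal with respect to
subalgebras and quotients. -/
structure IsCriticalSubpower (A : UAlgebra σ) (p : ℕ) (R : Set (ZMod p → A.carrier)) : Prop
    extends IsCyclicSubpower A p R where
  idempotent : Idempotent A
  card_lt : Nat.card A.carrier < p
  no_const : ∀ a, (fun _ => a) ∉ R
  eq_univ : ∀ C, Subuniverse A C → (∃ r ∈ R, ∀ i, r i ∈ C) → C = Set.univ
  simple : ∀ D : A.carrier → A.carrier → Prop, Compatible A A D → (∀ a, D a a) →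
    (∀ a b, D a b → D b a) → (∀ a b, Relation.ReflTransGen D a b) ∨ ∀ a b, D a b → a = b

namespace IsCriticalSubpower

variable {A : UAlgebra σ} {p : ℕ} {R : Set (ZMod p → A.carrier)}

theorem of_minimal [Finite A.carrier] (hR : IsCyclicSubpower A p R) (hI : Idempotent A)
    (hT : HasTaylorTerm A) (hcard : Nat.card A.carrier < p) (hc : ∀ a, (fun _ => a) ∉ R)
    (ih : ∀ B : UAlgebra σ, Finite B.carrier → Idempotent B → HasTaylorTerm B →
      Nat.card B.carrier < Nat.card A.carrier → HasConstantTuples B p) :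
    IsCriticalSubpower A p R := by
  have sub : ∀ C, Subuniverse A C → (∃ r ∈ R, ∀ i, r i ∈ C) → C = Set.univ := by
    intro C hC hr
    by_contra hne
    have hlt : Nat.card C < Nat.card A.carrier := by
      rw [Nat.card_coe_set_eq, ← Set.ncard_univ]
      exact Set.ncard_lt_ncard (Set.ssubset_univ_iff.2 hne) (Set.toFinite _)
    obtain ⟨a, ha⟩ := hR.exists_const_of_sub hC
      (ih (A.sub C hC) (inferInstanceAs (Finite C)) (fun s a => Subtype.ext (hI s a.1))
        (hT.of_injective (B := A.sub C hC) Subtype.val (fun _ _ => rfl) Subtype.val_injective)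
        hlt) hr
    exact hc a ha
  refine ⟨hR, hI, hcard, hc, sub, fun D hD hr hs => ?_⟩
  by_contra! hcon
  obtain ⟨⟨a, b, hab⟩, c, d, hcd, hne⟩ := hcon
  have hsymm : Std.Symm D := ⟨hs⟩
  let θ : Setoid A.carrier := ⟨Relation.ReflTransGen D, fun _ => .refl,
    fun h => Relation.ReflTransGen.stdSymm.symm _ _ h, fun h h' => h.trans h'⟩
  have hθ : Compatible A A θ.r := hD.reflTransGen hr
  have hsurj : Function.Surjective (Quotient.mk θ) := Quotient.mk_surjective
  have hfin : Finite (Quotient θ) := Finite.of_surjective _ hsurj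
  have hlt : Nat.card (Quotient θ) < Nat.card A.carrier := by
    have := Fintype.ofFinite A.carrier
    have := Fintype.ofFinite (Quotient θ)
    rw [Nat.card_eq_fintype_card, Nat.card_eq_fintype_card]
    exact Fintype.card_lt_of_surjective_not_injective _ hsurj
      fun hinj => hne (hinj (Quotient.sound (Relation.ReflTransGen.single hcd)))
  have hIq : Idempotent (A.quot θ) := by
    intro s x
    obtain ⟨x, rfl⟩ := hsurj x
    have h := UAlgebra.quot_op hθ s fun _ => x
    rw [hI] at h
    exact h.symm
  obtain ⟨r, hrR, e, he⟩ := hR.exists_block_of_quot hθ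
    (ih (A.quot θ) hfin hIq (hT.of_surjective (B := A.quot θ) _ (UAlgebra.quot_op hθ) hsurj) hlt)
  have huniv : {x | θ.r x e} = Set.univ := by
    refine sub _ (fun s x hx => ?_) ⟨r, hrR, he⟩
    have h := hθ s x (fun _ => e) hx
    rwa [hI] at h
  have hall : ∀ x, θ.r x e := fun x => by
    have : x ∈ {x | θ.r x e} := by rw [huniv]; trivial
    exact this
  exact hab (θ.trans (hall a) (θ.symm (hall b)))

variable [Fact p.Prime]

theorem exists_apply_eq (hR : IsCriticalSubpower A p R) (i : ZMod p) (a : A.carrier) :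
    ∃ r ∈ R, r i = a := by
  have h : {a | ∃ r ∈ R, r i = a} = Set.univ := by
    refine hR.eq_univ _ (fun s x hx => ?_) ?_
    · choose r hr hrx using hx
      exact ⟨_, hR.op_mem s r hr, by simp only [hrx]⟩
    · obtain ⟨r, hr⟩ := hR.nonempty
      exact ⟨r, hr, fun j => ⟨_, hR.shift_by_mem hr (j - i), by simp⟩⟩
  have : a ∈ {a | ∃ r ∈ R, r i = a} := by rw [h]; trivial
  exact this

/-- The elements `a` and `b` occur at distance `d` in a tuple of `R`. -/
def Edge (R : Set (ZMod p → A.carrier)) (d : ZMod p) (a b : A.carrier) : Prop :=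
  ∃ r ∈ R, r 0 = a ∧ r d = b

theorem edge_iff (hR : IsCriticalSubpower A p R) (i : ZMod p) {d : ZMod p} {a b : A.carrier} :
    Edge R d a b ↔ ∃ r ∈ R, r i = a ∧ r (i + d) = b := by
  constructor
  · rintro ⟨r, hr, rfl, rfl⟩
    exact ⟨_, hR.shift_by_mem hr (-i), by simp, by simp⟩
  · rintro ⟨r, hr, rfl, rfl⟩
    exact ⟨_, hR.shift_by_mem hr i, by simp, by simp [add_comm]⟩

theorem edge_compatible (hR : IsCriticalSubpower A p R) (d : ZMod p) :
    Compatible A A (Edge R d) := by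
  intro s x y h
  choose r hr hx hy using h
  exact ⟨_, hR.op_mem s r hr, by simp only [hx], by simp only [hy]⟩

theorem edge_neg (hR : IsCriticalSubpower A p R) {d : ZMod p} {a b : A.carrier} :
    Edge R (-d) a b ↔ Edge R d b a := by
  rw [hR.edge_iff d]
  simp only [add_neg_cancel]
  exact ⟨fun ⟨r, h1, h2, h3⟩ => ⟨r, h1, h3, h2⟩, fun ⟨r, h1, h2, h3⟩ => ⟨r, h1, h3, h2⟩⟩

theorem edge_comp_of_add (hR : IsCriticalSubpower A p R) {d e : ZMod p} {a b : A.carrier}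
    (h : Edge R (d + e) a b) : Relation.Comp (Edge R d) (Edge R e) a b := by
  obtain ⟨r, hr, rfl, rfl⟩ := h
  exact ⟨r d, ⟨r, hr, rfl, rfl⟩, (hR.edge_iff d).2 ⟨r, hr, rfl, rfl⟩⟩

theorem edge_zero (hR : IsCriticalSubpower A p R) {a b : A.carrier} :
    Edge R 0 a b ↔ a = b := by
  constructor
  · rintro ⟨r, -, rfl, rfl⟩; rfl
  · rintro rfl
    obtain ⟨r, hr, h⟩ := hR.exists_apply_eq 0 a
    exact ⟨r, hr, h, h⟩

theorem not_determined [Finite A.carrier] (hR : IsCriticalSubpower A p R) {d : ZMod p}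
    (hd : d ≠ 0) (h : ∀ a a' b, Edge R d a b → Edge R d a' b → a = a') : False := by
  have hinj : Function.Injective fun r : R => r.1 0 := by
    rintro ⟨r, hr⟩ ⟨r', hr'⟩ (h0 : r 0 = r' 0)
    have hmul : ∀ m : ℕ, r (-(m * d)) = r' (-(m * d)) := by
      intro m
      induction m with
      | zero => simpa using h0
      | succ m ih =>
        have hm : -(((m + 1 : ℕ) : ZMod p) * d) + d = -(m * d) := by push_cast; ring
        refine h _ _ (r (-(m * d))) ((hR.edge_iff _).2 ⟨r, hr, rfl, by rw [hm]⟩)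
          ((hR.edge_iff _).2 ⟨r', hr', rfl, by rw [hm, ih]⟩)
    refine Subtype.ext (funext fun i => ?_)
    have := hmul (-(i * d⁻¹)).val
    simpa [hd] using this
  have hle := Nat.card_le_card_of_injective _ hinj
  have : Nonempty R := hR.nonempty.to_subtype
  have := Nat.le_of_dvd Nat.card_pos (hR.prime_dvd_card hR.no_const)
  have := hR.card_lt
  omega

theorem edge_comp_neg_refl (hR : IsCriticalSubpower A p R) (d : ZMod p) (a : A.carrier) :
    Relation.Comp (Edge R d) (Edge R (-d)) a a :=
  hR.edge_comp_of_add (by rw [add_neg_cancel]; exact hR.edge_zero.2 rfl)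

theorem edge_linked [Finite A.carrier] (hR : IsCriticalSubpower A p R) {d : ZMod p}
    (hd : d ≠ 0) (a b : A.carrier) :
    Relation.ReflTransGen (Relation.Comp (Edge R d) (Edge R (-d))) a b := by
  rcases hR.simple _ ((hR.edge_compatible d).comp (hR.edge_compatible (-d)))
    (hR.edge_comp_neg_refl d)
    (fun a b ⟨c, h1, h2⟩ => ⟨c, hR.edge_neg.1 h2, hR.edge_neg.2 h1⟩) with h | h
  · exact h a b
  · exact (hR.not_determined hd fun a a' b h1 h2 => h _ _ ⟨b, h1, hR.edge_neg.2 h2⟩).elim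

section Absorbing

variable {n : ℕ} {t : Term σ n} {V U : Set A.carrier}

/-- `V` is advanced to `U` by some absorbing relation at a nonzero distance. -/
def StepTo (t : Term σ n) (R : Set (ZMod p → A.carrier)) (V U : Set A.carrier) : Prop :=
  ∃ d : ZMod p, d ≠ 0 ∧ Advances A t V U (Edge R d)

theorem exists_advances_of_transGen (hR : IsCriticalSubpower A p R)
    (h : Relation.TransGen (StepTo t R) V U) :
    ∃ d f : ZMod p, d ≠ 0 ∧ Advances A t V U (Relation.Comp (Edge R d) (Edge R f)) := by
  induction h with
  | single h =>
    obtain ⟨d, hd, h⟩ := h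
    exact ⟨d, 0, hd, h.mono fun a b ⟨c, hac, hcb⟩ => hR.edge_zero.1 hcb ▸ hac⟩
  | tail _ h ih =>
    obtain ⟨d, f, hd, h1⟩ := ih
    obtain ⟨d', -, h2⟩ := h
    refine ⟨d, f + d', hd, (h1.comp h2).mono fun a b ⟨c, hac, hcb⟩ => ?_⟩
    obtain ⟨e, hce, heb⟩ := hR.edge_comp_of_add hcb
    exact ⟨e, ⟨c, hac, hce⟩, heb⟩

theorem advances_iterate (hR : IsCriticalSubpower A p R) {d f : ZMod p}
    (h : Advances A t V V (Relation.Comp (Edge R d) (Edge R f))) (m : ℕ) :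
    Advances A t V V (Relation.Comp (Edge R d) (Edge R (f + m * (d + f)))) := by
  induction m with
  | zero => simpa using h
  | succ m ih =>
    refine (h.comp ih).mono fun a b ⟨c, hac, hcb⟩ => ?_
    have heq : f + ((m + 1 : ℕ) : ZMod p) * (d + f) = f + (d + (f + m * (d + f))) := by
      push_cast; ring
    rw [heq] at hcb
    obtain ⟨e, hce, heb⟩ := hR.edge_comp_of_add hcb
    exact ⟨e, ⟨c, hac, hce⟩, hR.edge_comp_of_add heb⟩

theorem eq_univ_of_transGen [Finite A.carrier] (hR : IsCriticalSubpower A p R)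
    (hV : V.Nonempty) (h : Relation.TransGen (StepTo t R) V V) : V = Set.univ := by
  obtain ⟨d, f, hd, h⟩ := hR.exists_advances_of_transGen h
  have h := hR.advances_iterate h (-1 : ZMod p).val
  have heq : f + ((-1 : ZMod p).val : ZMod p) * (d + f) = -d := by
    rw [ZMod.natCast_zmod_val]; ring
  rw [heq] at h
  exact h.eq_univ_of_linked hR.idempotent hV (hR.edge_comp_neg_refl d) (hR.edge_linked hd)

/-- A proper nonempty subuniverse absorbing the algebra with respect to `t`. -/
structure IsGood (t : Term σ n) (V : Set A.carrier) : Prop where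
  nonempty : V.Nonempty
  ne_univ : V ≠ Set.univ
  subuniverse : Subuniverse A V
  absorbs : AbsorbsWith A V t

theorem IsGood.exists_terminal [Finite A.carrier] (hR : IsCriticalSubpower A p R)
    (hV : IsGood t V) : ∃ T, IsGood t T ∧ ∀ U, IsGood t U → ¬ StepTo t R T U := by
  let r : {V // IsGood t V} → {V // IsGood t V} → Prop :=
    fun V U => Relation.TransGen (StepTo t R) U.1 V.1
  have htrans : IsTrans _ r := ⟨fun _ _ _ h h' => Relation.TransGen.trans h' h⟩
  have hirr : Std.Irrefl r :=
    ⟨fun V h => V.2.ne_univ (hR.eq_univ_of_transGen V.2.nonempty h)⟩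
  obtain ⟨T, -, hT⟩ :=
    (Finite.wellFounded_of_trans_of_irrefl r).has_min Set.univ ⟨⟨V, hV⟩, trivial⟩
  exact ⟨T.1, T.2, fun U hU h => hT ⟨U, hU⟩ trivial (.single h)⟩

theorem exists_mem_of_terminal (hR : IsCriticalSubpower A p R) {T : Set A.carrier}
    (hT : IsGood t T) (hTU : ∀ U, IsGood t U → ¬ StepTo t R T U)
    {R' : Set (ZMod p → A.carrier)} (hR' : Subuniverse (A.pi (ZMod p)) R')
    (habs : ∀ (k : Fin n) (r : Fin n → ZMod p → A.carrier), (∀ m, m ≠ k → r m ∈ R') → r k ∈ R →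
      (fun j => t.eval A fun m => r m j) ∈ R') {i j : ZMod p} (hij : i ≠ j)
    (hi : ∀ a, ∃ r ∈ R', r i = a) (hj : ∀ a, ∃ r ∈ R', r j = a) (b : A.carrier) :
    ∃ r ∈ R', r i ∈ T ∧ r j = b := by
  by_contra hb
  refine hTU {b | ∃ r ∈ R', r i ∈ T ∧ r j = b} ⟨?_, fun h => ?_, fun s x hx => ?_, ?_⟩
    ⟨j - i, sub_ne_zero.2 hij.symm, fun a b => ∃ r ∈ R', r i = a ∧ r j = b, ?_, ?_, ?_, ?_⟩
  · obtain ⟨a, ha⟩ := hT.nonempty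
    obtain ⟨r, hr, rfl⟩ := hi a
    exact ⟨r j, r, hr, ha, rfl⟩
  · exact hb (h ▸ Set.mem_univ b : b ∈ {b | ∃ r ∈ R', r i ∈ T ∧ r j = b})
  · choose r hr hri hrx using hx
    exact ⟨_, hR' s r hr, hT.subuniverse s _ hri, congrArg (A.op s) (funext hrx)⟩
  · intro k x hx
    have hex : ∀ m, ∃ r : ZMod p → A.carrier,
        (m ≠ k → r ∈ R' ∧ r i ∈ T) ∧ (m = k → r ∈ R) ∧ r j = x m := by
      intro m
      by_cases hm : m = k
      · obtain ⟨r, hr, hrx⟩ := hR.exists_apply_eq j (x m)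
        exact ⟨r, fun h => absurd hm h, fun _ => hr, hrx⟩
      · obtain ⟨r, hr, hri, hrx⟩ := hx m hm
        exact ⟨r, fun _ => ⟨hr, hri⟩, fun h => absurd h hm, hrx⟩
    choose r hr hrk hrx using hex
    exact ⟨_, habs k r (fun m hm => (hr m hm).1) (hrk k rfl),
      hT.absorbs k _ fun m hm => (hr m hm).2, congrArg (t.eval A) (funext hrx)⟩
  · intro k x y hxy hk
    obtain ⟨rk, hrk, hrki, hrkj⟩ := (hR.edge_iff i).1 hk
    rw [add_sub_cancel] at hrkj
    have hex : ∀ m, ∃ r : ZMod p → A.carrier,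
        (m ≠ k → r ∈ R') ∧ (m = k → r ∈ R) ∧ r i = x m ∧ r j = y m := by
      intro m
      by_cases hm : m = k
      · subst hm
        exact ⟨rk, fun h => absurd rfl h, fun _ => hrk, hrki, hrkj⟩
      · obtain ⟨r, hr, hrx, hry⟩ := hxy m hm
        exact ⟨r, fun _ => hr, fun h => absurd h hm, hrx, hry⟩
    choose r hr hrk hrx hry using hex
    exact ⟨_, habs k r hr (hrk k rfl), congrArg (t.eval A) (funext hrx),
      congrArg (t.eval A) (funext hry)⟩
  · exact fun a => (hi a).elim fun r h => ⟨r j, r, h.1, h.2, rfl⟩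
  · exact fun a => (hj a).elim fun r h => ⟨r i, r, h.1, rfl, h.2⟩
  · rintro _ ha b ⟨r, hr, rfl, rfl⟩
    exact ⟨r, hr, ha, rfl⟩

theorem exists_mem_of_finset (hR : IsCriticalSubpower A p R) {T : Set A.carrier}
    (hT : IsGood t T) (hTU : ∀ U, IsGood t U → ¬ StepTo t R T U) (J : Finset (ZMod p)) :
    ∀ j ∉ J, ∀ b, ∃ r ∈ R, (∀ i ∈ J, r i ∈ T) ∧ r j = b := by
  induction J using Finset.induction_on with
  | empty => exact fun j _ b => (hR.exists_apply_eq j b).imp fun r h => ⟨h.1, by simp, h.2⟩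
  | insert i J hi ih =>
    intro j hj b
    rw [Finset.mem_insert, not_or] at hj
    obtain ⟨r, ⟨hr, hrJ⟩, hri, hrj⟩ := hR.exists_mem_of_terminal hT hTU
      (R' := {r | r ∈ R ∧ ∀ i ∈ J, r i ∈ T})
      (fun s r hr => ⟨hR.op_mem s r fun m => (hr m).1,
        fun i hi => hT.subuniverse s _ fun m => (hr m).2 i hi⟩)
      (fun k r hr hk => ⟨hR.eval_mem t fun m => by
          by_cases hm : m = k
          · exact hm ▸ hk
          · exact (hr m hm).1,
        fun i hi => hT.absorbs k _ fun m hm => (hr m hm).2 i hi⟩)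
      (Ne.symm hj.1) (fun a => (ih i hi a).imp fun r h => ⟨⟨h.1, h.2.1⟩, h.2.2⟩)
      (fun a => (ih j hj.2 a).imp fun r h => ⟨⟨h.1, h.2.1⟩, h.2.2⟩) b
    refine ⟨r, hr, fun l hl => ?_, hrj⟩
    rcases Finset.mem_insert.1 hl with rfl | hl
    · exact hri
    · exact hrJ l hl

theorem absorptionFree [Finite A.carrier] (hR : IsCriticalSubpower A p R) :
    AbsorptionFree A := by
  rintro V ⟨hV, n, t, ht⟩ hne
  by_contra hun
  obtain ⟨T, hT, hTU⟩ := IsGood.exists_terminal hR (t := t) ⟨hne, hun, hV, ht⟩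
  obtain ⟨b, hb⟩ := hT.nonempty
  obtain ⟨r, hr, hrT, rfl⟩ := hR.exists_mem_of_finset hT hTU (Finset.univ.erase 0) 0 (by simp) b
  refine hT.ne_univ (hR.eq_univ T hT.subuniverse ⟨r, hr, fun i => ?_⟩)
  by_cases hi : i = 0
  · exact hi ▸ hb
  · exact hrT i (by simp [hi])

end Absorbing

theorem false_of_absorptionFree [Finite A.carrier] (hR : IsCriticalSubpower A p R)
    (hT : HasTaylorTerm A) (hA : AbsorptionFree A) : False := by
  classical
  obtain ⟨r₀, hr₀⟩ := hR.nonempty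
  have hne : Nonempty A.carrier := ⟨r₀ 0⟩
  obtain ⟨J, hJ⟩ := (Set.toFinite {J : Finset (ZMod p) | ∀ x : ZMod p → A.carrier,
    ∃ r ∈ R, ∀ i ∈ J, r i = x i}).exists_maximal ⟨∅, fun x => ⟨r₀, hr₀, by simp⟩⟩
  have hfull := hJ.prop
  have hdet : ∀ i ∉ J, ∀ r ∈ R, ∀ r' ∈ R, (∀ j ∈ J, r j = r' j) → r i = r' i := by
    intro i hi
    let N : (A.pi J).carrier → A.carrier → Prop :=
      fun y a => ∃ r ∈ R, (∀ j : J, r j = y j) ∧ r i = a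
    have hN : Compatible (A.pi J) A N := by
      intro s y x h
      choose r hr hry hrx using h
      exact ⟨_, hR.op_mem s r hr, fun j => congrArg (A.op s) (funext fun m => hry m j),
        congrArg (A.op s) (funext hrx)⟩
    have htot : ∀ y, ∃ a, N y a := by
      intro y
      obtain ⟨r, hr, hry⟩ := hfull fun j => if h : j ∈ J then y ⟨j, h⟩ else r₀ j
      exact ⟨r i, r, hr, fun j => by simpa using hry j j.2, rfl⟩
    have htot' : ∀ a, ∃ y, N y a := by
      intro a
      obtain ⟨r, hr, hra⟩ := hR.exists_apply_eq i a
      exact ⟨fun j => r j, r, hr, fun _ => rfl, hra⟩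
    rcases hR.simple _ (hN.swap.comp hN) (fun a => (htot' a).imp fun y h => ⟨h, h⟩)
      (fun a b ⟨y, h1, h2⟩ => ⟨y, h2, h1⟩) with h | h
    · have htop := hA.eq_top_of_linked hR.idempotent hT (hA.pi hR.idempotent J) hN htot htot' h
      refine absurd (hJ.le_of_ge (y := insert i J) (fun x => ?_) (Finset.subset_insert i J)
        (Finset.mem_insert_self i J)) hi
      obtain ⟨r, hr, hrJ, hri⟩ := htop (fun j => x j) (x i)
      refine ⟨r, hr, fun j hj => ?_⟩
      rcases Finset.mem_insert.1 hj with rfl | hj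
      · exact hri
      · exact hrJ ⟨j, hj⟩
    · exact fun r hr r' hr' heq => h _ _
        ⟨fun j => r j, ⟨r, hr, fun _ => rfl, rfl⟩, r', hr', fun j => (heq j j.2).symm, rfl⟩
  have hbij : Function.Bijective fun (r : R) (j : J) => r.1 j := by
    refine ⟨fun r r' h => Subtype.ext (funext fun i => ?_), fun y => ?_⟩
    · have h' : ∀ j ∈ J, r.1 j = r'.1 j := fun j hj => congrFun h ⟨j, hj⟩
      by_cases hi : i ∈ J
      · exact h' i hi
      · exact hdet i hi _ r.2 _ r'.2 h'
    · obtain ⟨r, hr, hry⟩ := hfull fun j => if h : j ∈ J then y ⟨j, h⟩ else r₀ j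
      exact ⟨⟨r, hr⟩, funext fun j => by simpa using hry j j.2⟩
  have hdvd := hR.prime_dvd_card hR.no_const
  rw [Nat.card_eq_of_bijective _ hbij, Nat.card_fun] at hdvd
  have := Nat.le_of_dvd Nat.card_pos ((Fact.out : p.Prime).dvd_of_dvd_pow hdvd)
  have := hR.card_lt
  omega

end IsCriticalSubpower

theorem HasTaylorTerm.hasConstantTuples {p : ℕ} [Fact p.Prime] {A : UAlgebra σ}
    [Finite A.carrier] (hT : HasTaylorTerm A) (hI : Idempotent A)
    (hcard : Nat.card A.carrier < p) : HasConstantTuples A p := by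
  induction hk : Nat.card A.carrier using Nat.strong_induction_on generalizing A with
  | _ k ih =>
    intro R hR
    by_contra! hc
    have hcrit := IsCriticalSubpower.of_minimal hR hI hT hcard hc fun B _ hIB hTB hlt =>
      ih _ (hk ▸ hlt) hTB hIB (hlt.trans hcard) rfl
    exact hcrit.false_of_absorptionFree hT hcrit.absorptionFree

end CyclicRelations

section CyclicTerms

variable {σ : Signature} {A : UAlgebra σ} {q : ℕ}

/-- The term takes the same value on all cyclic shifts of the tuple. -/
def Term.IsCyclicAt (t : Term σ (q + 1)) (x : Fin (q + 1) → A.carrier) : Prop :=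
  ∀ d : Fin (q + 1), t.eval A (fun i => x (i + d)) = t.eval A x

theorem HasConstantTuples.exists_isCyclicAt
    (h : HasConstantTuples A (q + 1)) (t : Term σ (q + 1)) (x : Fin (q + 1) → A.carrier) :
    ∃ t' : Term σ (q + 1), t'.IsCyclicAt x ∧
      ∀ z : Fin (q + 1) → A.carrier, t.IsCyclicAt z → t'.IsCyclicAt z := by
  let y : Fin (q + 1) → A.carrier := fun j => t.eval A fun l => x (l + j)
  let R : Set (Fin (q + 1) → A.carrier) :=
    {z | ∃ s : Term σ (q + 1), ∀ i, z i = s.eval A fun j => y (j + i)}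
  have hR : IsCyclicSubpower A (q + 1) R := by
    refine ⟨⟨y, .var 0, fun i => by simp [Term.eval]⟩, fun s r hr => ?_, ?_⟩
    · choose u hu using hr
      exact ⟨.app s u, fun i => congrArg (A.op s) (funext fun m => hu m i)⟩
    · rintro r ⟨s, hs⟩
      refine ⟨s.bind fun j => .var (j + 1), fun i => ?_⟩
      rw [Term.eval_bind]
      have hadd : ∀ i j : Fin (q + 1), j + (i + 1) = j + 1 + i := fun i j => by
        rw [add_right_comm, add_assoc]
      exact (hs (i + 1)).trans (congrArg (s.eval A) (funext fun j => congrArg y (hadd i j)))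
  obtain ⟨a, s, hs⟩ := h R hR
  have heval : ∀ z : Fin (q + 1) → A.carrier,
      (s.bind fun j => t.bind fun l => .var (l + j)).eval A z =
        s.eval A fun j => t.eval A fun l => z (l + j) := by
    intro z
    simp only [Term.eval_bind, Term.eval]
  refine ⟨s.bind fun j => t.bind fun l => .var (l + j), fun d => ?_, fun z hz d => ?_⟩
  · rw [heval, heval]
    have h0 := (hs d).symm.trans (hs 0)
    simpa only [y, add_assoc, add_zero] using h0
  · rw [heval, heval]
    have h1 : ∀ j, t.eval A (fun l => z (l + j)) = t.eval A z := hz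
    simp only [add_assoc, h1]

theorem HasConstantTuples.exists_cyclic [Finite A.carrier]
    (h : HasConstantTuples A (q + 1)) :
    ∃ t : Term σ (q + 1), ∀ x : Fin (q + 1) → A.carrier, t.IsCyclicAt x := by
  classical
  have := Fintype.ofFinite A.carrier
  have key : ∀ F : Finset (Fin (q + 1) → A.carrier),
      ∃ t : Term σ (q + 1), ∀ x ∈ F, t.IsCyclicAt x := by
    intro F
    induction F using Finset.induction_on with
    | empty => exact ⟨.var 0, by simp⟩
    | insert x F _ ih =>
      obtain ⟨t, ht⟩ := ih
      obtain ⟨t', h1, h2⟩ := h.exists_isCyclicAt t x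
      refine ⟨t', fun z hz => ?_⟩
      rcases Finset.mem_insert.1 hz with rfl | hz
      · exact h1
      · exact h2 z (ht z hz)
  obtain ⟨t, ht⟩ := key Finset.univ
  exact ⟨t, fun x => ht x (Finset.mem_univ x)⟩

end CyclicTerms

/-- A finite idempotent algebra in a Taylor variety (i.e. with
a Taylor term) has a `p`-ary cyclic term for every prime `p > |A|`. -/
theorem cyclic_term_exists {σ : Signature} (A : UAlgebra σ) [Fintype A.carrier]
    (hI : Idempotent A) (hT : ∃ (k : ℕ) (t : Term σ k), IsTaylorTerm A t)
    (p : ℕ) (hp : p.Prime) (hcard : Fintype.card A.carrier < p) :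
    ∃ s : Term σ p, IsCyclicTerm A s := by
  have : Fact p.Prime := ⟨hp⟩
  have h : HasConstantTuples A p :=
    HasTaylorTerm.hasConstantTuples hT hI (by rwa [Nat.card_eq_fintype_card])
  obtain ⟨q, rfl⟩ := Nat.exists_eq_succ_of_ne_zero hp.ne_zero
  obtain ⟨t, ht⟩ := h.exists_cyclic
  refine ⟨t, Term.eval_const hI t, fun x => ?_⟩
  have hshift : cycShift x = fun i => x (i + 1) := by
    funext i
    refine congrArg x (Fin.ext ?_)
    simp [Fin.val_add]
  rw [hshift]
  exact (ht x 1).symm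
end

section
/- Let G be a finite non-bipartite undirected loopless graph which contains an edge, and let p be a prime number greater than both the number of vertices of G and the length of some fixed odd closed walk. Then G has no p-ary cyclic polymorphism; equivalently, the relation R = {(a_0,...,a_{p-1}) : a_0 → a_1 → ... → a_{p-1} → a_0 is a closed walk in G} is a nonempty cyclic relation preserved by all polymorphisms of G and containing no constant tuple. -/
/-- Directed walks of length `k`. -/
def steps {α : Type} (E : α → α → Prop) : ℕ → α → α → Prop
  | 0, a, b => a = b
  | k + 1, a, b => ∃ c, E a c ∧ steps E k c b

/-- The set of closed walks of length `p` in `G`, viewed as `p`-tuples. -/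
def walkRel {V : Type} (G : V → V → Prop) (p : ℕ) : Set (Fin p → V) :=
  {f | ∀ i, G (f i) (cycShift f i)}

theorem exists_path_of_steps {α : Type} {E : α → α → Prop} {n : ℕ} {a b : α}
    (h : steps E n a b) :
    ∃ f : ℕ → α, f 0 = a ∧ f n = b ∧ ∀ i < n, E (f i) (f (i + 1)) := by
  induction n generalizing a with
  | zero => exact ⟨fun _ => a, rfl, h, by simp⟩
  | succ n ih =>
    obtain ⟨c, hac, hcb⟩ := h
    obtain ⟨f, hf0, hfn, hf⟩ := ih hcb
    refine ⟨fun i => Nat.casesOn i a f, rfl, hfn, ?_⟩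
    rintro (_ | i) hi
    · simpa [hf0] using hac
    · exact hf i (by omega)

theorem steps_add_two_mul {α : Type} {E : α → α → Prop} (hsymm : ∀ a b, E a b → E b a)
    {n : ℕ} {a b c : α} (hac : E a c) (h : steps E n a b) (k : ℕ) :
    steps E (n + 2 * k) a b := by
  induction k with
  | zero => exact h
  | succ k ih => exact ⟨c, hac, a, hsymm a c hac, ih⟩

theorem walkRel_nonempty_of_steps {V : Type} {G : V → V → Prop} {p : ℕ} {a : V}
    (h : steps G p a a) : (walkRel G p).Nonempty := by
  obtain ⟨f, hf0, hfp, hf⟩ := exists_path_of_steps h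
  refine ⟨fun i => f i.val, fun i => ?_⟩
  have hi := hf i.val i.isLt
  rcases Nat.lt_or_ge (i.val + 1) p with hlt | hge
  · simpa [cycShift, Nat.mod_eq_of_lt hlt] using hi
  · have hip : i.val + 1 = p := by omega
    rw [hip, hfp, ← hf0] at hi
    simpa [cycShift, hip] using hi

/-- Let `G` be a finite loopless symmetric graph containing an
edge and an odd closed walk (so non-bipartite), and let `p` be a prime greater
than the number of vertices and than the length `2m+1` of the odd closed walk.
Then `G` has no `p`-ary cyclic polymorphism; equivalently, the relation of closed
walks of length `p` is nonempty, cyclic, preserved by all polymorphisms of `G`,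
and contains no constant tuple. -/
theorem no_cyclic_polymorphism {V : Type} [Fintype V] (G : V → V → Prop)
    (hsymm : ∀ a b, G a b → G b a) (hirr : ∀ a, ¬G a a)
    (hedge : ∃ a b, G a b)
    (m : ℕ) (a₀ : V) (hodd : steps G (2 * m + 1) a₀ a₀)
    (p : ℕ) (hp : p.Prime) (hpV : Fintype.card V < p) (hpm : 2 * m + 1 < p) :
    (¬∃ t : (Fin p → V) → V,
        (∀ x y : Fin p → V, (∀ i, G (x i) (y i)) → G (t x) (t y)) ∧
        ∀ x : Fin p → V, t x = t (cycShift x)) ∧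
    (walkRel G p).Nonempty ∧
    (∀ f ∈ walkRel G p, cycShift f ∈ walkRel G p) ∧
    (∀ (k : ℕ) (h : (Fin k → V) → V),
        (∀ x y : Fin k → V, (∀ i, G (x i) (y i)) → G (h x) (h y)) →
        ∀ F : Fin k → (Fin p → V), (∀ i, F i ∈ walkRel G p) →
          (fun j => h fun i => F i j) ∈ walkRel G p) ∧
    (¬∃ a : V, (fun _ => a) ∈ walkRel G p) := by
  have hne : (walkRel G p).Nonempty := by
    obtain ⟨c, hc, -⟩ := id hodd
    have hm : m ≠ 0 := by
      rintro rfl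
      obtain ⟨d, hd, rfl⟩ := hodd
      exact hirr _ hd
    obtain ⟨k, hk⟩ := hp.odd_of_ne_two (by omega)
    have hpk : p = 2 * m + 1 + 2 * (k - m) := by omega
    rw [hpk]
    exact walkRel_nonempty_of_steps (steps_add_two_mul hsymm hc hodd _)
  refine ⟨?_, hne, fun f hf i => hf _, fun k h hh F hF j => hh _ _ fun i => hF i j, ?_⟩
  · rintro ⟨t, ht, hcyc⟩
    obtain ⟨f, hf⟩ := hne
    have hloop := ht f (cycShift f) hf
    rw [← hcyc f] at hloop
    exact hirr _ hloop
  · rintro ⟨a, ha⟩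
    exact hirr a (ha ⟨0, hp.pos⟩)
end
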